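/- arXiv:2108.06997 — 12 statements merged into one kernel-verified Lean document; each statement's English description precedes it below -/
import Mathlib

section
/- Let K be a field and C a K-algebra with an internal ℕ-grading C = ⊕_{j∈ℕ} C_j in which every homogeneous component C_j is finite-dimensional over K. Suppose C is a Noetherian ring. If A ⊆ C is a K-subalgebra for which there exists k₀ with C_j ⊆ A for all j ≥ k₀ (a full rank one subalgebra), then A is a Noetherian ring. -/
/-- A subalgebra of finite codimension in a left Noetherian algebra over a field is left
Noetherian. -/
theorem isNoetherianRing_subalgebra_of_sup_eq_top {K C : Type*} [Field K] [Ring C] [Algebra K C]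
    (hC : IsNoetherianRing C) (A : Subalgebra K C) (V : Submodule K C) (hV : V.FG)
    (hVA : V ⊔ Subalgebra.toSubmodule A = ⊤) : IsNoetherianRing A := by
  classical
  refine ⟨fun I => ?_⟩
  obtain ⟨T, hTI, hT⟩ := (Submodule.fg_span_iff_fg_span_finset_subset (R := C)
    ((↑) '' (I : Set A) : Set C)).1 (IsNoetherian.noetherian _)
  let N : Submodule A A := Submodule.span A ((↑) ⁻¹' (T : Set C))
  have hNI : N ≤ I := by
    refine Submodule.span_le.2 fun x hx => ?_
    obtain ⟨y, hy, hyx⟩ := hTI hx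
    rwa [← Subtype.ext hyx]
  let F : Submodule K C := V * Submodule.span K (T : Set C)
  have hF : F.FG := hV.mul (Submodule.fg_span T.finite_toSet)
  have hIF : ∀ y ∈ I, (y : C) ∈ (N.restrictScalars K).map A.val.toLinearMap ⊔ F := by
    intro y hy
    have hyT : (y : C) ∈ Submodule.span C (T : Set C) :=
      hT ▸ Submodule.subset_span ⟨y, hy, rfl⟩
    obtain ⟨f, -, hf⟩ := Submodule.mem_span_finset.1 hyT
    rw [← hf]
    refine Submodule.sum_mem _ fun t ht => ?_
    obtain ⟨v, hv, a, ha, hva⟩ := Submodule.mem_sup.1 (hVA ▸ Submodule.mem_top : f t ∈ _)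
    obtain ⟨x, -, hx⟩ := hTI ht
    rw [← hva, smul_eq_mul, add_mul, add_comm]
    refine Submodule.add_mem_sup ⟨⟨a, ha⟩ * x, ?_, ?_⟩
      (Submodule.mul_mem_mul hv (Submodule.subset_span ht))
    · exact N.smul_mem ⟨a, ha⟩ (Submodule.subset_span (by simpa [hx] using ht))
    · simp [hx]
  let G : Submodule K A := I.restrictScalars K ⊓ F.comap A.val.toLinearMap
  have hG : G.FG := by
    have : FiniteDimensional K F := Module.Finite.iff_fg.2 hF
    refine Submodule.fg_of_fg_map_injective A.val.toLinearMap Subtype.val_injective ?_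
    have hle : G.map A.val.toLinearMap ≤ F := Submodule.map_le_iff_le_comap.2 inf_le_right
    exact Module.Finite.iff_fg.1 (Submodule.finiteDimensional_of_le hle)
  obtain ⟨s, hs⟩ := hG
  have hI : I = N ⊔ Submodule.span A (s : Set A) := by
    apply le_antisymm
    · intro y hy
      obtain ⟨_, ⟨n, hn, rfl⟩, w, hw, hnw⟩ := Submodule.mem_sup.1 (hIF y hy)
      have hyn : y - n ∈ G := by
        refine ⟨I.sub_mem hy (hNI hn), ?_⟩
        have : w = (y : C) - n := by rw [← hnw]; simp
        simpa [this] using hw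
      rw [← hs] at hyn
      have hyn' : y - n ∈ Submodule.span A (s : Set A) :=
        Submodule.span_le_restrictScalars K A _ hyn
      simpa using Submodule.add_mem_sup (show n ∈ N from hn) hyn'
    · refine sup_le hNI (Submodule.span_le.2 fun x hx => ?_)
      have hxG : x ∈ G := hs ▸ Submodule.subset_span hx
      exact hxG.1
  rw [hI]
  exact (Submodule.fg_span (T.finite_toSet.preimage Subtype.val_injective.injOn)).sup
    (Submodule.fg_span s.finite_toSet)

/-- A full rank one subalgebra of an ℕ-graded Noetherian K-algebra whose
homogeneous components are all finite dimensional over K is a Noetherian ring. -/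
theorem stmt_1 {K C : Type*} [Field K] [Ring C] [Algebra K C]
    (𝒜 : ℕ → Submodule K C) [GradedAlgebra 𝒜]
    (hfin : ∀ j : ℕ, FiniteDimensional K (𝒜 j))
    (hC : IsNoetherianRing C)
    (A : Subalgebra K C) (k₀ : ℕ)
    (hA : ∀ j, k₀ ≤ j → 𝒜 j ≤ Subalgebra.toSubmodule A) :
    IsNoetherianRing A := by
  classical
  refine isNoetherianRing_subalgebra_of_sup_eq_top hC A (⨆ j ∈ Finset.range k₀, 𝒜 j)
    (Submodule.fg_biSup _ _ fun j _ => Module.Finite.iff_fg.1 (hfin j)) ?_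
  rw [eq_top_iff, ← (DirectSum.Decomposition.isInternal 𝒜).submodule_iSup_eq_top]
  refine iSup_le fun j => ?_
  rcases lt_or_ge j k₀ with hj | hj
  · exact (le_biSup 𝒜 (Finset.mem_range.2 hj)).trans le_sup_left
  · exact (hA j hj).trans le_sup_right
end

section
/- Let K be a field, C a K-algebra with an internal ℕ-grading C = ⊕_{j∈ℕ} C_j, and Γ, A ⊆ C two K-subalgebras. Suppose: (1) there exists k₀ ∈ ℕ such that C_j ⊆ Γ for every j ≥ k₀; let E = Γ ∩ (⊕_{j=0}^{k₀−1} C_j); (2) Γ is generated as a K-algebra by E, i.e. Γ equals the K-subalgebra generated by E; (3) A ∩ (⊕_{j=0}^{k₀−1} C_j) = E. Then Γ = A. -/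
/-- If Γ is a full rank one subalgebra of an ℕ-graded K-algebra C
(with C_j ⊆ Γ for j ≥ k₀), E = Γ ∩ (⊕_{j<k₀} C_j), Γ is generated as a K-algebra by E,
and A ∩ (⊕_{j<k₀} C_j) = E, then Γ = A. -/
theorem stmt_2 {K C : Type*} [Field K] [Ring C] [Algebra K C]
    (𝒜 : ℕ → Submodule K C) [GradedAlgebra 𝒜]
    (Γ A : Subalgebra K C) (k₀ : ℕ)
    (h1 : ∀ j, k₀ ≤ j → 𝒜 j ≤ Subalgebra.toSubmodule Γ)
    (E : Submodule K C)
    (hE : E = Subalgebra.toSubmodule Γ ⊓ (⨆ j ∈ Finset.range k₀, 𝒜 j))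
    (h2 : Algebra.adjoin K (E : Set C) = Γ)
    (h3 : Subalgebra.toSubmodule A ⊓ (⨆ j ∈ Finset.range k₀, 𝒜 j) = E) :
    Γ = A := by
  have hEA : E ≤ Subalgebra.toSubmodule A := h3 ▸ inf_le_left
  have hEΓ : E ≤ Subalgebra.toSubmodule Γ := hE ▸ inf_le_left
  have hΓA : Γ ≤ A := h2 ▸ Algebra.adjoin_le hEA
  refine le_antisymm hΓA fun a ha => ?_
  have hdecomp : a ∈ (⨆ j ∈ Finset.range k₀, 𝒜 j) ⊔ Subalgebra.toSubmodule Γ := by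
    have htop : (⨆ j, 𝒜 j) ≤ (⨆ j ∈ Finset.range k₀, 𝒜 j) ⊔ Subalgebra.toSubmodule Γ := by
      refine iSup_le fun j => ?_
      rcases lt_or_ge j k₀ with hj | hj
      · exact le_sup_of_le_left (le_iSup₂_of_le j (Finset.mem_range.mpr hj) le_rfl)
      · exact (h1 j hj).trans le_sup_right
    rw [(DirectSum.Decomposition.isInternal 𝒜).submodule_iSup_eq_top] at htop
    exact htop Submodule.mem_top
  obtain ⟨x, hx, y, hy, rfl⟩ := Submodule.mem_sup.mp hdecomp
  have hxA : x ∈ A := by simpa using A.sub_mem ha (hΓA hy)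
  have hxE : x ∈ E := h3 ▸ Submodule.mem_inf.mpr ⟨hxA, hx⟩
  exact Γ.add_mem (hEΓ hxE) hy
end

section
/- For all θ₁, θ₂ ∈ M_N(K[x]): P_0(θ₁θ₂) = ∑_{s=0}^{D} { P_0(x^s θ₁(x))·(θ₂)_s + (θ₁)_s·P_0(x^s θ₂(x)) } − (θ₁θ₂)_1, where (θ₁θ₂)_1 denotes the coefficient of x in the product θ₁θ₂ (equal to (θ₁θ₂)'(0) in characteristic 0). -/
open Polynomial Finset

/-- The map P_k(θ) = (k+1)·θ_{k+1} − ∑_{j=k+2}^{k+D} (−1)^{j−k} [θ_j, S^{j−k−1}],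
acting on matrix polynomials θ ∈ M_N(K[x]) (encoded as polynomials with N×N matrix
coefficients), where S ∈ M_N(K) and [A,B] = AB − BA. -/
noncomputable def Pk {K : Type*} [Field K] {N : ℕ} (D : ℕ) (S : Matrix (Fin N) (Fin N) K)
    (k : ℕ) (θ : Polynomial (Matrix (Fin N) (Fin N) K)) : Matrix (Fin N) (Fin N) K :=
  (k + 1) • θ.coeff (k + 1) -
    ∑ j ∈ Finset.Icc (k + 2) (k + D),
      ((-1 : K) ^ (j - k)) • (θ.coeff j * S ^ (j - k - 1) - S ^ (j - k - 1) * θ.coeff j)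

theorem sum_coeff_X_pow_mul_mul_coeff {R : Type*} [Semiring R] (p q : R[X]) {j D : ℕ}
    (hj : j ≤ D) :
    ∑ s ∈ Finset.range (D + 1), (X ^ s * p).coeff j * q.coeff s = (p * q).coeff j := by
  rw [coeff_mul, ← Finset.Nat.sum_antidiagonal_swap,
    Finset.Nat.sum_antidiagonal_eq_sum_range_succ_mk,
    ← Finset.sum_subset (Finset.range_subset_range.2 (Nat.succ_le_succ hj))]
  · refine Finset.sum_congr rfl fun s hs => ?_
    have hs' : s ≤ j := Nat.lt_succ_iff.1 (Finset.mem_range.1 hs)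
    simp only [coeff_X_pow_mul', hs', if_true, Prod.swap]
  · intro s _ hs
    have hs' : ¬ s ≤ j := fun h => hs (Finset.mem_range.2 (Nat.lt_succ_of_le h))
    simp [coeff_X_pow_mul', hs']

theorem sum_coeff_mul_coeff_X_pow_mul {R : Type*} [Semiring R] (p q : R[X]) {j D : ℕ}
    (hj : j ≤ D) :
    ∑ s ∈ Finset.range (D + 1), p.coeff s * (X ^ s * q).coeff j = (p * q).coeff j := by
  rw [coeff_mul, Finset.Nat.sum_antidiagonal_eq_sum_range_succ_mk,
    ← Finset.sum_subset (Finset.range_subset_range.2 (Nat.succ_le_succ hj))]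
  · refine Finset.sum_congr rfl fun s hs => ?_
    have hs' : s ≤ j := Nat.lt_succ_iff.1 (Finset.mem_range.1 hs)
    simp only [coeff_X_pow_mul', hs', if_true]
  · intro s _ hs
    have hs' : ¬ s ≤ j := fun h => hs (Finset.mem_range.2 (Nat.lt_succ_of_le h))
    simp [coeff_X_pow_mul', hs']

/-- The Leibniz rule for the commutator with `T`, summed over the coefficients of a product. -/
theorem sum_commutator_coeff_X_pow_mul {R : Type*} [Ring R] (p q : R[X]) (T : R) {j D : ℕ}
    (hj : j ≤ D) :
    ∑ s ∈ Finset.range (D + 1),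
      (((X ^ s * p).coeff j * T - T * (X ^ s * p).coeff j) * q.coeff s +
        p.coeff s * ((X ^ s * q).coeff j * T - T * (X ^ s * q).coeff j)) =
      (p * q).coeff j * T - T * (p * q).coeff j := by
  have h₁ := sum_coeff_X_pow_mul_mul_coeff (p * C T) q hj
  have h₂ := sum_coeff_mul_coeff_X_pow_mul (p * C T) q hj
  simp only [← mul_assoc, coeff_mul_C] at h₁ h₂
  have h₃ : ∑ s ∈ Finset.range (D + 1), T * (X ^ s * p).coeff j * q.coeff s =
      T * (p * q).coeff j := by
    simp only [mul_assoc, ← Finset.mul_sum]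
    rw [sum_coeff_X_pow_mul_mul_coeff p q hj]
  have h₄ : ∑ s ∈ Finset.range (D + 1), p.coeff s * (X ^ s * q).coeff j * T =
      (p * q).coeff j * T := by
    rw [← Finset.sum_mul, sum_coeff_mul_coeff_X_pow_mul p q hj]
  simp only [sub_mul, mul_sub, ← mul_assoc, Finset.sum_add_distrib, Finset.sum_sub_distrib]
  rw [h₁, h₂, h₃, h₄]
  abel

theorem Pk_zero {K : Type*} [Field K] {N : ℕ} (D : ℕ) (S : Matrix (Fin N) (Fin N) K)
    (θ : Polynomial (Matrix (Fin N) (Fin N) K)) :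
    Pk D S 0 θ = θ.coeff 1 -
      ∑ j ∈ Finset.Icc 2 D,
        ((-1 : K) ^ j) • (θ.coeff j * S ^ (j - 1) - S ^ (j - 1) * θ.coeff j) := by
  simp [Pk]

/-- Product formula for P₀:
P_0(θ₁θ₂) = ∑_{s=0}^{D} { P_0(x^s θ₁)·(θ₂)_s + (θ₁)_s·P_0(x^s θ₂) } − (θ₁θ₂)_1. -/
theorem stmt_5 {K : Type*} [Field K] {N : ℕ} (hN : 1 ≤ N) (D : ℕ) (hD : 2 ≤ D)
    (S : Matrix (Fin N) (Fin N) K) (hS : S ^ D = 0)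
    (θ₁ θ₂ : Polynomial (Matrix (Fin N) (Fin N) K)) :
    Pk D S 0 (θ₁ * θ₂) =
      (∑ s ∈ Finset.range (D + 1),
        (Pk D S 0 (X ^ s * θ₁) * θ₂.coeff s + θ₁.coeff s * Pk D S 0 (X ^ s * θ₂))) -
      (θ₁ * θ₂).coeff 1 := by
  have hsplit : ∀ s, Pk D S 0 (X ^ s * θ₁) * θ₂.coeff s + θ₁.coeff s * Pk D S 0 (X ^ s * θ₂) =
      ((X ^ s * θ₁).coeff 1 * θ₂.coeff s + θ₁.coeff s * (X ^ s * θ₂).coeff 1) -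
        ∑ j ∈ Finset.Icc 2 D, ((-1 : K) ^ j) •
          (((X ^ s * θ₁).coeff j * S ^ (j - 1) - S ^ (j - 1) * (X ^ s * θ₁).coeff j) *
              θ₂.coeff s +
            θ₁.coeff s *
              ((X ^ s * θ₂).coeff j * S ^ (j - 1) - S ^ (j - 1) * (X ^ s * θ₂).coeff j)) := by
    intro s
    rw [Pk_zero, Pk_zero, sub_mul, mul_sub]
    simp only [smul_add, Finset.sum_add_distrib, Finset.sum_mul, Finset.mul_sum,
      smul_mul_assoc, mul_smul_comm]
    abel
  have hD₁ : 1 ≤ D := by omega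
  simp only [hsplit]
  rw [Finset.sum_sub_distrib, Finset.sum_add_distrib, sum_coeff_X_pow_mul_mul_coeff θ₁ θ₂ hD₁,
    sum_coeff_mul_coeff_X_pow_mul θ₁ θ₂ hD₁, Finset.sum_comm, Pk_zero]
  have hcomm := Finset.sum_congr (rfl : Finset.Icc 2 D = Finset.Icc 2 D) fun j hj =>
    congrArg (fun M => ((-1 : K) ^ j) • M)
      (sum_commutator_coeff_X_pow_mul θ₁ θ₂ (S ^ (j - 1)) (Finset.mem_Icc.1 hj).2)
  simp only [Finset.smul_sum] at hcomm
  rw [hcomm]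
  abel
end

section
/- If θ₁, θ₂ ∈ M_N(K[x]) and θ₁(0) = 0, then P_0(θ₁θ₂) = P_0(θ₁)·θ₂(0) − (θ₁)_1·P_0(θ₂(0)·x) + ∑_{s=1}^{D} { P_0(x^s θ₁(x))·(θ₂)_s + (θ₁)_s·P_0(x^s θ₂(x)) }, where (θ₁)_1 is the coefficient of x in θ₁ (equal to θ₁'(0) in characteristic 0). -/
open Polynomial Finset

/-- A coefficient of low degree of a product as a sum over the coefficients of the left factor. -/
theorem coeff_mul_eq_sum_left {R : Type*} [Semiring R] (p q : R[X]) {j D : ℕ} (hj : j ≤ D) :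
    (p * q).coeff j = ∑ s ∈ range (D + 1), p.coeff s * (X ^ s * q).coeff j := by
  simp only [coeff_X_pow_mul', mul_ite, mul_zero]
  rw [coeff_mul, Finset.Nat.sum_antidiagonal_eq_sum_range_succ (fun i k => p.coeff i * q.coeff k),
    ← Finset.sum_filter]
  refine Finset.sum_congr ?_ fun _ _ => rfl
  ext s
  simp only [mem_range, mem_filter]
  omega

/-- A coefficient of low degree of a product as a sum over the coefficients of the right factor. -/
theorem coeff_mul_eq_sum_right {R : Type*} [Semiring R] (p q : R[X]) {j D : ℕ} (hj : j ≤ D) :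
    (p * q).coeff j = ∑ s ∈ range (D + 1), (X ^ s * p).coeff j * q.coeff s := by
  simp only [coeff_X_pow_mul', ite_mul, zero_mul]
  rw [coeff_mul, ← Finset.Nat.sum_antidiagonal_swap,
    Finset.Nat.sum_antidiagonal_eq_sum_range_succ_mk, ← Finset.sum_filter]
  refine Finset.sum_congr ?_ fun _ _ => rfl
  ext s
  simp only [mem_range, mem_filter]
  omega

/-- The Leibniz rule for the commutator of a coefficient of a product with a constant. -/
theorem coeff_mul_commutator {R : Type*} [Ring R] (p q : R[X]) (T : R) {j D : ℕ} (hj : j ≤ D) :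
    (p * q).coeff j * T - T * (p * q).coeff j =
      ∑ s ∈ range (D + 1),
        (((X ^ s * p).coeff j * T - T * (X ^ s * p).coeff j) * q.coeff s +
          p.coeff s * ((X ^ s * q).coeff j * T - T * (X ^ s * q).coeff j)) := by
  have hmid := (coeff_mul_eq_sum_left p (C T * q) hj).symm.trans
    (coeff_mul_eq_sum_right p (C T * q) hj)
  have hX (s : ℕ) : (X ^ s * (C T * q)).coeff j = T * (X ^ s * q).coeff j := by
    rw [← mul_assoc, X_pow_mul_C, mul_assoc, coeff_C_mul]
  simp only [hX, coeff_C_mul] at hmid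
  calc (p * q).coeff j * T - T * (p * q).coeff j
      = (∑ s ∈ range (D + 1), p.coeff s * (X ^ s * q).coeff j) * T -
          T * ∑ s ∈ range (D + 1), (X ^ s * p).coeff j * q.coeff s := by
        rw [← coeff_mul_eq_sum_left p q hj, ← coeff_mul_eq_sum_right p q hj]
    _ = _ := by
        simp only [sub_mul, mul_sub, Finset.sum_add_distrib, Finset.sum_sub_distrib, hmid,
          Finset.sum_mul, Finset.mul_sum, mul_assoc]
        abel

/-- The sum of commutators in `Pk D S 0`. -/
noncomputable def commutatorSum {K : Type*} [Field K] {N : ℕ} (D : ℕ)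
    (S : Matrix (Fin N) (Fin N) K) (θ : Polynomial (Matrix (Fin N) (Fin N) K)) :
    Matrix (Fin N) (Fin N) K :=
  ∑ j ∈ Finset.Icc 2 D,
    ((-1 : K) ^ j) • (θ.coeff j * S ^ (j - 1) - S ^ (j - 1) * θ.coeff j)

theorem Pk_zero_eq {K : Type*} [Field K] {N : ℕ} (D : ℕ) (S : Matrix (Fin N) (Fin N) K)
    (θ : Polynomial (Matrix (Fin N) (Fin N) K)) :
    Pk D S 0 θ = θ.coeff 1 - commutatorSum D S θ := by
  simp [Pk, commutatorSum]

theorem commutatorSum_mul {K : Type*} [Field K] {N : ℕ} (D : ℕ) (S : Matrix (Fin N) (Fin N) K)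
    (p q : Polynomial (Matrix (Fin N) (Fin N) K)) :
    commutatorSum D S (p * q) =
      ∑ s ∈ range (D + 1), (commutatorSum D S (X ^ s * p) * q.coeff s +
        p.coeff s * commutatorSum D S (X ^ s * q)) := by
  simp only [commutatorSum, Finset.sum_mul, Finset.mul_sum, ← Finset.sum_add_distrib]
  rw [Finset.sum_comm]
  refine Finset.sum_congr rfl fun j hj => ?_
  rw [coeff_mul_commutator p q _ (Finset.mem_Icc.mp hj).2, Finset.smul_sum]
  exact Finset.sum_congr rfl fun s _ => by rw [smul_add, smul_mul_assoc, mul_smul_comm]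

theorem commutatorSum_C_mul_X {K : Type*} [Field K] {N : ℕ} (D : ℕ)
    (S : Matrix (Fin N) (Fin N) K) (A : Matrix (Fin N) (Fin N) K) :
    commutatorSum D S (C A * X) = 0 := by
  refine Finset.sum_eq_zero fun j hj => ?_
  have hj1 : j ≠ 1 := by have := (Finset.mem_Icc.mp hj).1; omega
  simp [coeff_C_mul, coeff_X_of_ne_one hj1]

/-- If θ₁(0) = 0, then
P_0(θ₁θ₂) = P_0(θ₁)·θ₂(0) − (θ₁)_1·P_0(θ₂(0)·x)
  + ∑_{s=1}^{D} { P_0(x^s θ₁)·(θ₂)_s + (θ₁)_s·P_0(x^s θ₂) }. -/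
theorem stmt_7 {K : Type*} [Field K] {N : ℕ} (hN : 1 ≤ N) (D : ℕ) (hD : 2 ≤ D)
    (S : Matrix (Fin N) (Fin N) K) (hS : S ^ D = 0)
    (θ₁ θ₂ : Polynomial (Matrix (Fin N) (Fin N) K)) (h0 : θ₁.coeff 0 = 0) :
    Pk D S 0 (θ₁ * θ₂) =
      Pk D S 0 θ₁ * θ₂.coeff 0 - θ₁.coeff 1 * Pk D S 0 (C (θ₂.coeff 0) * X) +
        ∑ s ∈ Finset.Icc 1 D,
          (Pk D S 0 (X ^ s * θ₁) * θ₂.coeff s + θ₁.coeff s * Pk D S 0 (X ^ s * θ₂)) := by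
  have hrange : range (D + 1) = insert 0 (Finset.Icc 1 D) := by
    ext s
    simp only [mem_range, mem_insert, Finset.mem_Icc]
    omega
  have hone : (θ₁ * θ₂).coeff 1 = ∑ s ∈ Finset.Icc 1 D, θ₁.coeff s * (X ^ s * θ₂).coeff 1 := by
    rw [coeff_mul_eq_sum_left θ₁ θ₂ (by omega : 1 ≤ D), hrange, Finset.sum_insert (by simp), h0,
      zero_mul, zero_add]
  have hone' : (θ₁ * θ₂).coeff 1 = θ₁.coeff 1 * θ₂.coeff 0 +
      ∑ s ∈ Finset.Icc 1 D, (X ^ s * θ₁).coeff 1 * θ₂.coeff s := by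
    rw [coeff_mul_eq_sum_right θ₁ θ₂ (by omega : 1 ≤ D), hrange, Finset.sum_insert (by simp),
      pow_zero, one_mul]
  have hprod : (θ₁ * θ₂).coeff 1 = θ₁.coeff 1 * θ₂.coeff 0 := by
    simp [coeff_mul, Finset.Nat.antidiagonal_succ, h0]
  have hzero : ∑ s ∈ Finset.Icc 1 D, (X ^ s * θ₁).coeff 1 * θ₂.coeff s = 0 := by
    simpa [hprod] using hone'
  simp only [Pk_zero_eq, commutatorSum_C_mul_X, commutatorSum_mul D S θ₁ θ₂, hrange, coeff_C_mul,
    coeff_X_one, mul_one, sub_zero, sub_mul, mul_sub, Finset.sum_add_distrib,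
    Finset.sum_sub_distrib, hzero, ← hone, hprod]
  rw [Finset.sum_insert (by simp), Finset.sum_insert (by simp)]
  simp only [h0, zero_mul, pow_zero, one_mul]
  abel
end

section
/- If θ₁, θ₂ ∈ M_N(K[x]) satisfy θ₁(0) = 0 and θ₂(0) = 0, then P_0(θ₁θ₂) = ∑_{s=1}^{D} { P_0(x^s θ₁(x))·(θ₂)_s + (θ₁)_s·P_0(x^s θ₂(x)) }. -/
open Polynomial Finset

/-- A sum over the antidiagonal of `j ≤ D` whose terms vanish at second index `0` is a sum over
the second index running through `Icc 1 D`. -/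
theorem sum_antidiagonal_eq_sum_Icc_one {M : Type*} [AddCommMonoid M] {D j : ℕ} (hj : j ≤ D)
    (f : ℕ → ℕ → M) (h0 : f j 0 = 0) :
    ∑ p ∈ antidiagonal j, f p.1 p.2 = ∑ s ∈ Icc 1 D, if s ≤ j then f (j - s) s else 0 := by
  rw [← Finset.Nat.sum_antidiagonal_swap, Finset.Nat.sum_antidiagonal_eq_sum_range_succ_mk,
    ← Finset.sum_filter]
  symm
  apply Finset.sum_subset
  · intro s hs
    simp only [mem_filter, mem_Icc, mem_range] at hs ⊢
    omega
  · intro s hs hs'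
    simp only [mem_filter, mem_Icc, mem_range] at hs hs'
    obtain rfl : s = 0 := by omega
    simpa using h0

section TwistedCauchyProduct

variable {R : Type*} [Ring R] {D j : ℕ} (T : R) (a b : R[X])

theorem sum_coeff_X_pow_mul_mul_coeff_s8 (hj : j ≤ D) (hb : b.coeff 0 = 0) :
    ∑ s ∈ Icc 1 D, (X ^ s * a).coeff j * T * b.coeff s =
      ∑ p ∈ antidiagonal j, a.coeff p.1 * T * b.coeff p.2 := by
  rw [sum_antidiagonal_eq_sum_Icc_one hj (fun m n ↦ a.coeff m * T * b.coeff n) (by simp [hb])]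
  refine Finset.sum_congr rfl fun s _ ↦ ?_
  rw [coeff_X_pow_mul']
  split_ifs <;> simp

theorem sum_coeff_mul_coeff_X_pow_mul_s8 (hj : j ≤ D) (ha : a.coeff 0 = 0) :
    ∑ s ∈ Icc 1 D, a.coeff s * T * (X ^ s * b).coeff j =
      ∑ p ∈ antidiagonal j, a.coeff p.1 * T * b.coeff p.2 := by
  rw [← Finset.Nat.sum_antidiagonal_swap]
  simp only [Prod.fst_swap, Prod.snd_swap]
  rw [sum_antidiagonal_eq_sum_Icc_one hj (fun m n ↦ a.coeff n * T * b.coeff m) (by simp [ha])]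
  refine Finset.sum_congr rfl fun s _ ↦ ?_
  rw [coeff_X_pow_mul']
  split_ifs <;> simp

/-- Leibniz rule for the commutator of a coefficient of a product with a fixed element. -/
theorem commutator_coeff_mul (hj : j ≤ D) (ha : a.coeff 0 = 0) (hb : b.coeff 0 = 0) :
    (a * b).coeff j * T - T * (a * b).coeff j =
      ∑ s ∈ Icc 1 D,
        (((X ^ s * a).coeff j * T - T * (X ^ s * a).coeff j) * b.coeff s +
          a.coeff s * ((X ^ s * b).coeff j * T - T * (X ^ s * b).coeff j)) := by
  have h₁ := sum_coeff_X_pow_mul_mul_coeff_s8 1 a b hj hb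
  have h₂ := sum_coeff_mul_coeff_X_pow_mul_s8 1 a b hj ha
  simp only [mul_one, ← coeff_mul] at h₁ h₂
  simp only [sub_mul, mul_sub, Finset.sum_add_distrib, Finset.sum_sub_distrib]
  simp only [← mul_assoc]
  rw [sum_coeff_X_pow_mul_mul_coeff_s8 T a b hj hb, sum_coeff_mul_coeff_X_pow_mul_s8 T a b hj ha,
    ← Finset.sum_mul, h₂]
  simp only [mul_assoc T, ← Finset.mul_sum, h₁]
  abel

end TwistedCauchyProduct

theorem Pk_zero_of_coeff_one_eq_zero {K : Type*} [Field K] {N : ℕ} (D : ℕ)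
    (S : Matrix (Fin N) (Fin N) K) {θ : Polynomial (Matrix (Fin N) (Fin N) K)}
    (h : θ.coeff 1 = 0) :
    Pk D S 0 θ =
      -∑ j ∈ Icc 2 D, ((-1 : K) ^ j) • (θ.coeff j * S ^ (j - 1) - S ^ (j - 1) * θ.coeff j) := by
  simp [Pk, h]

/-- If θ₁(0) = 0 and θ₂(0) = 0, then
P_0(θ₁θ₂) = ∑_{s=1}^{D} { P_0(x^s θ₁)·(θ₂)_s + (θ₁)_s·P_0(x^s θ₂) }. -/
theorem stmt_8 {K : Type*} [Field K] {N : ℕ} (hN : 1 ≤ N) (D : ℕ) (hD : 2 ≤ D)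
    (S : Matrix (Fin N) (Fin N) K) (hS : S ^ D = 0)
    (θ₁ θ₂ : Polynomial (Matrix (Fin N) (Fin N) K))
    (h1 : θ₁.coeff 0 = 0) (h2 : θ₂.coeff 0 = 0) :
    Pk D S 0 (θ₁ * θ₂) =
      ∑ s ∈ Finset.Icc 1 D,
        (Pk D S 0 (X ^ s * θ₁) * θ₂.coeff s + θ₁.coeff s * Pk D S 0 (X ^ s * θ₂)) := by
  have hX (θ : Polynomial (Matrix (Fin N) (Fin N) K)) (h : θ.coeff 0 = 0) (s : ℕ)
      (hs : s ∈ Icc 1 D) : (X ^ s * θ).coeff 1 = 0 := by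
    rw [coeff_X_pow_mul']
    split_ifs with hs1
    · rwa [Nat.sub_eq_zero_of_le (mem_Icc.mp hs).1]
    · rfl
  have hmul : (θ₁ * θ₂).coeff 1 = 0 := by
    simp [coeff_mul, Finset.Nat.antidiagonal_succ, h1, h2]
  have hterm : ∀ s ∈ Icc 1 D,
      Pk D S 0 (X ^ s * θ₁) * θ₂.coeff s + θ₁.coeff s * Pk D S 0 (X ^ s * θ₂) =
        -∑ j ∈ Icc 2 D, ((-1 : K) ^ j) •
          (((X ^ s * θ₁).coeff j * S ^ (j - 1) - S ^ (j - 1) * (X ^ s * θ₁).coeff j) *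
              θ₂.coeff s +
            θ₁.coeff s *
              ((X ^ s * θ₂).coeff j * S ^ (j - 1) - S ^ (j - 1) * (X ^ s * θ₂).coeff j)) := by
    intro s hs
    rw [Pk_zero_of_coeff_one_eq_zero D S (hX θ₁ h1 s hs),
      Pk_zero_of_coeff_one_eq_zero D S (hX θ₂ h2 s hs), neg_mul, mul_neg, ← neg_add,
      Finset.sum_mul, Finset.mul_sum, ← Finset.sum_add_distrib]
    simp only [smul_mul_assoc, mul_smul_comm, smul_add]
  rw [Pk_zero_of_coeff_one_eq_zero D S hmul, Finset.sum_congr rfl hterm,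
    Finset.sum_neg_distrib, Finset.sum_comm]
  congr 1
  refine Finset.sum_congr rfl fun j hj ↦ ?_
  rw [← Finset.smul_sum, commutator_coeff_mul _ _ _ (mem_Icc.mp hj).2 h1 h2]
end

section
/- For every k ∈ ℕ and all θ₁, θ₂ ∈ M_N(K[x]): P_k(θ₁θ₂) = ∑_{t=0}^{k+D} { P_k(x^t θ₁(x))·(θ₂)_t + (θ₁)_t·P_k(x^t θ₂(x)) } − (k+1)·(θ₁θ₂)_{k+1}, where (θ₁θ₂)_{k+1} is the (k+1)-st coefficient of the product (so that (k+1)·(θ₁θ₂)_{k+1} = (θ₁θ₂)^{(k+1)}(0)/k! in characteristic 0). -/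
open Polynomial Finset

/-- Convolving with an element `T` in the middle, written with the left factor shifted by `X ^ t`. -/
theorem sum_coeff_X_pow_mul_left {R : Type*} [Semiring R] (p q : R[X]) (T : R) {j n : ℕ}
    (hj : j < n) :
    ∑ t ∈ range n, (X ^ t * p).coeff j * T * q.coeff t =
      ∑ x ∈ antidiagonal j, p.coeff x.1 * T * q.coeff x.2 := by
  rw [← Nat.sum_antidiagonal_swap, Nat.sum_antidiagonal_eq_sum_range_succ_mk]
  symm
  refine sum_subset_zero_on_sdiff (range_subset_range.mpr hj) (fun t ht => ?_) fun t ht => ?_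
  · have : ¬ t ≤ j := by simp only [mem_sdiff, mem_range] at ht; lia
    simp [coeff_X_pow_mul', this]
  · have : t ≤ j := by simp only [mem_range] at ht; lia
    simp [coeff_X_pow_mul', this]

/-- Convolving with an element `T` in the middle, written with the right factor shifted by `X ^ t`. -/
theorem sum_coeff_X_pow_mul_right {R : Type*} [Semiring R] (p q : R[X]) (T : R) {j n : ℕ}
    (hj : j < n) :
    ∑ t ∈ range n, p.coeff t * T * (X ^ t * q).coeff j =
      ∑ x ∈ antidiagonal j, p.coeff x.1 * T * q.coeff x.2 := by
  rw [Nat.sum_antidiagonal_eq_sum_range_succ_mk]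
  symm
  refine sum_subset_zero_on_sdiff (range_subset_range.mpr hj) (fun t ht => ?_) fun t ht => ?_
  · have : ¬ t ≤ j := by simp only [mem_sdiff, mem_range] at ht; lia
    simp [coeff_X_pow_mul', this]
  · have : t ≤ j := by simp only [mem_range] at ht; lia
    simp [coeff_X_pow_mul', this]

/-- Product formula for P_k:
P_k(θ₁θ₂) = ∑_{t=0}^{k+D} { P_k(x^t θ₁)·(θ₂)_t + (θ₁)_t·P_k(x^t θ₂) } − (k+1)·(θ₁θ₂)_{k+1}. -/
theorem stmt_10 {K : Type*} [Field K] {N : ℕ} (hN : 1 ≤ N) (D : ℕ) (hD : 2 ≤ D)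
    (S : Matrix (Fin N) (Fin N) K) (hS : S ^ D = 0)
    (k : ℕ) (θ₁ θ₂ : Polynomial (Matrix (Fin N) (Fin N) K)) :
    Pk D S k (θ₁ * θ₂) =
      (∑ t ∈ Finset.range (k + D + 1),
        (Pk D S k (X ^ t * θ₁) * θ₂.coeff t + θ₁.coeff t * Pk D S k (X ^ t * θ₂))) -
      (k + 1) • (θ₁ * θ₂).coeff (k + 1) := by
  have hcomm (j : ℕ) (hj : j < k + D + 1) (T : Matrix (Fin N) (Fin N) K) :
      (θ₁ * θ₂).coeff j * T - T * (θ₁ * θ₂).coeff j =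
        ∑ t ∈ range (k + D + 1),
          (((X ^ t * θ₁).coeff j * T - T * (X ^ t * θ₁).coeff j) * θ₂.coeff t +
            θ₁.coeff t * ((X ^ t * θ₂).coeff j * T - T * (X ^ t * θ₂).coeff j)) := by
    have h₁ := sum_coeff_X_pow_mul_left θ₁ θ₂ T hj
    have h₂ := sum_coeff_X_pow_mul_right θ₁ θ₂ T hj
    have h₃ := sum_coeff_X_pow_mul_left θ₁ θ₂ 1 hj
    have h₄ := sum_coeff_X_pow_mul_right θ₁ θ₂ 1 hj
    simp only [mul_one, ← coeff_mul] at h₃ h₄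
    simp only [sub_mul, mul_sub, sum_add_distrib, sum_sub_distrib]
    rw [h₁]
    simp only [mul_assoc T, ← mul_assoc (θ₁.coeff _), ← mul_sum, ← sum_mul, h₂, h₃, h₄]
    abel
  have hk : k + 1 < k + D + 1 := by lia
  have h₃ := sum_coeff_X_pow_mul_left θ₁ θ₂ 1 hk
  have h₄ := sum_coeff_X_pow_mul_right θ₁ θ₂ 1 hk
  simp only [mul_one, ← coeff_mul] at h₃ h₄
  have hsum : ∑ j ∈ Icc (k + 2) (k + D), ((-1 : K) ^ (j - k)) •
        ((θ₁ * θ₂).coeff j * S ^ (j - k - 1) - S ^ (j - k - 1) * (θ₁ * θ₂).coeff j) =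
      ∑ t ∈ range (k + D + 1),
        ((∑ j ∈ Icc (k + 2) (k + D), ((-1 : K) ^ (j - k)) •
          ((X ^ t * θ₁).coeff j * S ^ (j - k - 1) - S ^ (j - k - 1) * (X ^ t * θ₁).coeff j)) *
            θ₂.coeff t +
          θ₁.coeff t * ∑ j ∈ Icc (k + 2) (k + D), ((-1 : K) ^ (j - k)) •
          ((X ^ t * θ₂).coeff j * S ^ (j - k - 1) - S ^ (j - k - 1) * (X ^ t * θ₂).coeff j)) := by
    simp only [sum_mul, mul_sum, ← sum_add_distrib]
    rw [sum_comm]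
    refine sum_congr rfl fun j hj => ?_
    rw [hcomm j (by have := (mem_Icc.mp hj).2; lia), smul_sum]
    exact sum_congr rfl fun t _ => by rw [smul_add, smul_mul_assoc, mul_smul_comm]
  simp only [Pk]
  rw [hsum]
  simp only [sub_mul, mul_sub, sum_add_distrib, sum_sub_distrib, smul_mul_assoc, mul_smul_comm,
    ← smul_sum, h₃, h₄]
  abel
end

section
/- For every θ ∈ M_N(K[x]), every k ∈ ℕ and every t ∈ ℕ, the following translation formula holds: (a) if 0 ≤ t ≤ k, then P_k(x^t θ(x)) = P_k(θ_{k+1−t}·x^{k+1}) + P_{k−t}(θ) − (k−t+1)·θ_{k−t+1}; (b) if t = k+1, then P_k(x^{k+1} θ(x)) = P_k(θ(0)·x^{k+1}) + P_0(x·(θ(x) − θ(0))); (c) if t ≥ k+2, then P_k(x^t θ(x)) = P_0(x^{t−k} θ(x)). -/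
open Polynomial Finset

theorem Pk_eq_sum_range {K : Type*} [Field K] {N : ℕ} (D : ℕ) (S : Matrix (Fin N) (Fin N) K)
    (k : ℕ) (θ : Polynomial (Matrix (Fin N) (Fin N) K)) :
    Pk D S k θ = (k + 1) • θ.coeff (k + 1) -
      ∑ i ∈ Finset.range (D - 1), ((-1 : K) ^ i) •
        (θ.coeff (k + (i + 2)) * S ^ (i + 1) - S ^ (i + 1) * θ.coeff (k + (i + 2))) := by
  unfold Pk
  congr 1
  rw [← Finset.Ico_add_one_right_eq_Icc, Finset.sum_Ico_eq_sum_range,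
    show k + D + 1 - (k + 2) = D - 1 by omega]
  refine Finset.sum_congr rfl fun i _ => ?_
  rw [show k + 2 + i = k + (i + 2) by omega, show k + (i + 2) - k = i + 2 by omega,
    show i + 2 - 1 = i + 1 by omega]
  simp [pow_add]

/-- Translation: (a) if t ≤ k then
P_k(x^t θ) = P_k(θ_{k+1−t}·x^{k+1}) + P_{k−t}(θ) − (k−t+1)·θ_{k−t+1};
(b) if t = k+1 then P_k(x^t θ) = P_k(θ(0)·x^{k+1}) + P_0(x·(θ − θ(0)));
(c) if t ≥ k+2 then P_k(x^t θ) = P_0(x^{t−k} θ). -/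
theorem stmt_11 {K : Type*} [Field K] {N : ℕ} (hN : 1 ≤ N) (D : ℕ) (hD : 2 ≤ D)
    (S : Matrix (Fin N) (Fin N) K) (hS : S ^ D = 0)
    (θ : Polynomial (Matrix (Fin N) (Fin N) K)) (k t : ℕ) :
    (t ≤ k →
      Pk D S k (X ^ t * θ) =
        Pk D S k (C (θ.coeff (k + 1 - t)) * X ^ (k + 1)) + Pk D S (k - t) θ -
          (k - t + 1) • θ.coeff (k - t + 1)) ∧
    (t = k + 1 →
      Pk D S k (X ^ t * θ) =
        Pk D S k (C (θ.coeff 0) * X ^ (k + 1)) + Pk D S 0 (X * (θ - C (θ.coeff 0)))) ∧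
    (k + 2 ≤ t →
      Pk D S k (X ^ t * θ) = Pk D S 0 (X ^ (t - k) * θ)) := by
  simp only [Pk_eq_sum_range]
  refine ⟨fun h => ?_, fun h => ?_, fun h => ?_⟩
  · have hc (i : ℕ) : (X ^ t * θ).coeff (k + (i + 2)) = θ.coeff (k - t + (i + 2)) := by
      rw [coeff_X_pow_mul', if_pos (by omega),
        show k + (i + 2) - t = k - t + (i + 2) by omega]
    have h1 : (X ^ t * θ).coeff (k + 1) = θ.coeff (k + 1 - t) := by
      rw [coeff_X_pow_mul', if_pos (by omega)]
    simp only [hc, h1]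
    simp [coeff_X_pow, -nsmul_eq_mul]
    abel
  · subst h
    have hc (i : ℕ) : (X ^ (k + 1) * θ).coeff (k + (i + 2)) = θ.coeff (i + 1) := by
      rw [coeff_X_pow_mul', if_pos (by omega), show k + (i + 2) - (k + 1) = i + 1 by omega]
    have h0 (i : ℕ) :
        (X * (θ - C (θ.coeff 0))).coeff (0 + (i + 2)) = θ.coeff (i + 1) := by
      rw [show 0 + (i + 2) = i + 1 + 1 by omega, coeff_X_mul]
      simp
    have h1 : (X ^ (k + 1) * θ).coeff (k + 1) = θ.coeff 0 := by
      simp [coeff_X_pow_mul']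
    simp only [hc, h0, h1]
    simp [coeff_X_pow, -nsmul_eq_mul]
    abel
  · have hc (i : ℕ) :
        (X ^ t * θ).coeff (k + (i + 2)) = (X ^ (t - k) * θ).coeff (0 + (i + 2)) := by
      simp only [coeff_X_pow_mul']
      rw [show k + (i + 2) - t = 0 + (i + 2) - (t - k) by omega]
      exact if_congr (by omega) rfl rfl
    have h1 : (X ^ t * θ).coeff (k + 1) = 0 := by
      rw [coeff_X_pow_mul', if_neg (by omega)]
    have h0 : (X ^ (t - k) * θ).coeff (0 + 1) = 0 := by
      rw [coeff_X_pow_mul', if_neg (by omega)]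
    simp only [hc, h1, h0, smul_zero]
end

section
/- For θ ∈ M_N(K[x]), the two conditions 'P_0(x·θ(x)) = P_0(θ(0)·x) and P_0(x^j·θ(x)) = 0 for all j ≥ 2' hold if and only if for every q with 0 ≤ q ≤ D−1 one has ∑_{j=0}^{q} (−1)^{q−j−D} [S^{D−q+j−1}, θ_j] = 0. -/
open Polynomial Finset

/-- The sign-weighted commutator sum appearing in `Pk D S 0 (X ^ m * θ)`. -/
theorem sum_commutator_X_pow_mul {K : Type*} [Field K] {N : ℕ} (D : ℕ)
    (S : Matrix (Fin N) (Fin N) K) (θ : Polynomial (Matrix (Fin N) (Fin N) K))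
    {m : ℕ} (hm : 1 ≤ m) :
    ∑ j ∈ Finset.Icc 2 D, ((-1 : K) ^ j) •
        ((X ^ m * θ).coeff j * S ^ (j - 1) - S ^ (j - 1) * (X ^ m * θ).coeff j) =
      -∑ i ∈ Finset.range (D + 1 - m), ((-1 : K) ^ (m + i)) •
        (S ^ (m + i - 1) * θ.coeff i - θ.coeff i * S ^ (m + i - 1)) := by
  have h₁ : Finset.Icc 2 D ⊆ Finset.Ico 1 (D + 1) := by
    intro j; simp only [Finset.mem_Icc, Finset.mem_Ico]; omega
  have h₂ : Finset.Ico m (D + 1) ⊆ Finset.Ico 1 (D + 1) :=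
    Finset.Ico_subset_Ico_left hm
  rw [Finset.sum_subset h₁, ← Finset.sum_subset h₂, Finset.sum_Ico_eq_sum_range,
    ← Finset.sum_neg_distrib]
  · refine Finset.sum_congr rfl fun i _ => ?_
    rw [Nat.add_comm m i, coeff_X_pow_mul, ← smul_neg, neg_sub]
  · intro j hj hj'
    have hlt : ¬ m ≤ j := by
      simp only [Finset.mem_Ico] at hj hj'; omega
    simp [coeff_X_pow_mul', hlt]
  · intro j hj hj'
    obtain rfl : j = 1 := by
      simp only [Finset.mem_Icc, Finset.mem_Ico] at hj hj'; omega
    simp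

/-- The value of `P_0` on `X ^ m * θ`: a linear term plus a sign-weighted commutator sum. -/
theorem Pk_zero_X_pow_mul {K : Type*} [Field K] {N : ℕ} (D : ℕ)
    (S : Matrix (Fin N) (Fin N) K) (θ : Polynomial (Matrix (Fin N) (Fin N) K))
    {m : ℕ} (hm : 1 ≤ m) :
    Pk D S 0 (X ^ m * θ) = (X ^ m * θ).coeff 1 +
      ∑ i ∈ Finset.range (D + 1 - m), ((-1 : K) ^ (m + i)) •
        (S ^ (m + i - 1) * θ.coeff i - θ.coeff i * S ^ (m + i - 1)) := by
  simp only [Pk, zero_add, Nat.sub_zero, one_smul]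
  rw [sum_commutator_X_pow_mul D S θ hm, sub_neg_eq_add]

theorem Pk_zero_C_mul_X {K : Type*} [Field K] {N : ℕ} (D : ℕ)
    (S A : Matrix (Fin N) (Fin N) K) : Pk D S 0 (C A * X) = A := by
  simp only [Pk, zero_add, Nat.sub_zero, one_smul]
  rw [Finset.sum_eq_zero]
  · simp
  · intro j hj
    have hne : (1 : ℕ) ≠ j := by
      simp only [Finset.mem_Icc] at hj; omega
    simp [coeff_C_mul, coeff_X, hne]

/-- The conditions 'P_0(x·θ) = P_0(θ(0)·x) and P_0(x^j·θ) = 0 for all j ≥ 2'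
hold iff for every 0 ≤ q ≤ D−1, ∑_{j=0}^{q} (−1)^{q−j−D} [S^{D−q+j−1}, θ_j] = 0
(the sign (−1)^{q−j−D} is encoded as (−1)^{D−q+j}, which has the same parity). -/
theorem stmt_12 {K : Type*} [Field K] {N : ℕ} (hN : 1 ≤ N) (D : ℕ) (hD : 2 ≤ D)
    (S : Matrix (Fin N) (Fin N) K) (hS : S ^ D = 0)
    (θ : Polynomial (Matrix (Fin N) (Fin N) K)) :
    (Pk D S 0 (X * θ) = Pk D S 0 (C (θ.coeff 0) * X) ∧
      ∀ j, 2 ≤ j → Pk D S 0 (X ^ j * θ) = 0) ↔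
    (∀ q, q < D →
      ∑ j ∈ Finset.range (q + 1),
        ((-1 : K) ^ (D - q + j)) •
          (S ^ (D - q + j - 1) * θ.coeff j - θ.coeff j * S ^ (D - q + j - 1)) = 0) := by
  have hX : Pk D S 0 (X * θ) = θ.coeff 0 +
      ∑ i ∈ Finset.range D, ((-1 : K) ^ (1 + i)) •
        (S ^ (1 + i - 1) * θ.coeff i - θ.coeff i * S ^ (1 + i - 1)) := by
    have h := Pk_zero_X_pow_mul D S θ le_rfl
    rwa [pow_one, coeff_X_mul, Nat.add_sub_cancel] at h
  have hpow : ∀ m, 2 ≤ m → Pk D S 0 (X ^ m * θ) =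
      ∑ i ∈ Finset.range (D + 1 - m), ((-1 : K) ^ (m + i)) •
        (S ^ (m + i - 1) * θ.coeff i - θ.coeff i * S ^ (m + i - 1)) := by
    intro m hm
    rw [Pk_zero_X_pow_mul D S θ (by omega), coeff_X_pow_mul', if_neg (by omega), zero_add]
  rw [hX, Pk_zero_C_mul_X, add_eq_left]
  constructor
  · rintro ⟨h₁, h₂⟩ q hq
    obtain rfl | hq' : q = D - 1 ∨ 2 ≤ D - q := by omega
    · rwa [show D - (D - 1) = 1 by omega, show D - 1 + 1 = D by omega]
    · have h := h₂ (D - q) hq'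
      rwa [hpow _ hq', show D + 1 - (D - q) = q + 1 by omega] at h
  · intro h
    refine ⟨?_, fun m hm => ?_⟩
    · have h₁ := h (D - 1) (by omega)
      rwa [show D - (D - 1) = 1 by omega, show D - 1 + 1 = D by omega] at h₁
    · rw [hpow m hm]
      by_cases hmD : m ≤ D
      · have h₂ := h (D - m) (by omega)
        rwa [show D - (D - m) = m by omega, show D - m + 1 = D + 1 - m by omega] at h₂
      · rw [show D + 1 - m = 0 by omega, Finset.sum_range_zero]
end

section
/- The set Γ is a K-subalgebra of M_N(K[x]): it contains the identity matrix, is closed under addition and scalar multiplication by K, and is closed under matrix-polynomial multiplication (in particular, if θ₁, θ₂ ∈ Γ then θ₁θ₂ ∈ Γ). -/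
open Polynomial Finset

/-- The set Γ of matrix polynomials θ ∈ M_N(K[x]) satisfying
(i) P_0(x·θ) = P_0(θ(0)·x), (ii) P_0(x^j·θ) = 0 for all j ≥ 2, and
(iii) ∑_{k=0}^{q} (−1)^k S^{k+D−q−1} P_k(θ) = 0 for every 0 ≤ q ≤ D−1. -/
noncomputable def GammaSet {K : Type*} [Field K] {N : ℕ} (D : ℕ)
    (S : Matrix (Fin N) (Fin N) K) : Set (Polynomial (Matrix (Fin N) (Fin N) K)) :=
  {θ | Pk D S 0 (X * θ) = Pk D S 0 (C (θ.coeff 0) * X) ∧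
       (∀ j, 2 ≤ j → Pk D S 0 (X ^ j * θ) = 0) ∧
       (∀ q, q < D →
         ∑ k ∈ Finset.range (q + 1),
           ((-1 : K) ^ k) • (S ^ (k + D - q - 1) * Pk D S k θ) = 0)}

section Evaluation

variable {A : Type*} [Ring A]

/-- Evaluation at `T` with the powers of `T` written to the left of the coefficients. -/
noncomputable def leftEval (T : A) (f : A[X]) : A := f.sum fun i a => T ^ i * a

/-- The two-sided difference quotient `∑ₙ ∑_{k + m = n - 1} T ^ k * fₙ * T ^ m`. -/
noncomputable def twoSidedQuot (T : A) (f : A[X]) : A :=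
  f.sum fun n a => ∑ k ∈ Finset.range n, T ^ k * a * T ^ (n - 1 - k)

theorem leftEval_add (T : A) (f g : A[X]) :
    leftEval T (f + g) = leftEval T f + leftEval T g :=
  sum_add_index f g _ (by simp) (by simp [mul_add])

theorem leftEval_monomial (T : A) (n : ℕ) (a : A) : leftEval T (monomial n a) = T ^ n * a :=
  sum_monomial_index a _ (by simp)

theorem leftEval_C (T a : A) : leftEval T (C a) = a := by
  simpa using leftEval_monomial T 0 a

theorem twoSidedQuot_add (T : A) (f g : A[X]) :
    twoSidedQuot T (f + g) = twoSidedQuot T f + twoSidedQuot T g :=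
  sum_add_index f g _ (by simp) (by simp [mul_add, add_mul, Finset.sum_add_distrib])

theorem twoSidedQuot_monomial (T : A) (n : ℕ) (a : A) :
    twoSidedQuot T (monomial n a) = ∑ k ∈ Finset.range n, T ^ k * a * T ^ (n - 1 - k) :=
  sum_monomial_index a _ (by simp)

theorem twoSidedQuot_C (T a : A) : twoSidedQuot T (C a) = 0 := by
  simpa using twoSidedQuot_monomial T 0 a

theorem leftEval_X_sub_C_mul (T : A) (f : A[X]) : leftEval T ((X - C T) * f) = 0 := by
  induction f using Polynomial.induction_on' with
  | add f g hf hg => rw [mul_add, leftEval_add, hf, hg, add_zero]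
  | monomial n a =>
    have h : (X - C T) * monomial n a = monomial (n + 1) a + monomial n (-(T * a)) := by
      rw [sub_mul, X_mul_monomial, C_mul_monomial, map_neg, sub_eq_add_neg]
    rw [h, leftEval_add, leftEval_monomial, leftEval_monomial, pow_succ]
    noncomm_ring

theorem twoSidedQuot_mul_X_sub_C (T : A) (f : A[X]) :
    twoSidedQuot T (f * (X - C T)) = leftEval T f := by
  induction f using Polynomial.induction_on' with
  | add f g hf hg => rw [add_mul, twoSidedQuot_add, leftEval_add, hf, hg]
  | monomial n a =>
    have h : monomial n a * (X - C T) = monomial (n + 1) a + monomial n (-(a * T)) := by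
      rw [mul_sub, monomial_mul_X, monomial_mul_C, map_neg, sub_eq_add_neg]
    rw [h, twoSidedQuot_add, twoSidedQuot_monomial, twoSidedQuot_monomial, leftEval_monomial,
      Finset.sum_range_succ]
    have h' : ∑ k ∈ Finset.range n, T ^ k * a * T ^ (n + 1 - 1 - k) =
        -∑ k ∈ Finset.range n, T ^ k * -(a * T) * T ^ (n - 1 - k) := by
      rw [← Finset.sum_neg_distrib]
      refine Finset.sum_congr rfl fun k hk => ?_
      have hk := Finset.mem_range.1 hk
      obtain ⟨m, rfl⟩ : ∃ m, n = k + m + 1 := ⟨n - k - 1, by omega⟩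
      rw [show k + m + 1 + 1 - 1 - k = m + 1 by omega, show k + m + 1 - 1 - k = m by omega,
        pow_succ']
      noncomm_ring
    rw [h']
    simp

theorem exists_eq_mul_X_sub_C_add_C (T : A) (f : A[X]) :
    ∃ g r, f = g * (X - C T) + C r := by
  induction f using Polynomial.induction_on' with
  | add f₁ f₂ h₁ h₂ =>
    obtain ⟨g₁, r₁, h₁⟩ := h₁
    obtain ⟨g₂, r₂, h₂⟩ := h₂
    exact ⟨g₁ + g₂, r₁ + r₂, by rw [h₁, h₂, add_mul, C_add]; abel⟩
  | monomial n a =>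
    induction n generalizing a with
    | zero => exact ⟨0, a, by simp⟩
    | succ n ih =>
      obtain ⟨g, r, h⟩ := ih (a * T)
      refine ⟨g + monomial n a, r, ?_⟩
      rw [add_mul, mul_sub (monomial n a), monomial_mul_X, monomial_mul_C, h]
      abel

theorem exists_eq_X_sub_C_mul_add_C (T : A) (f : A[X]) :
    ∃ g r, f = (X - C T) * g + C r := by
  induction f using Polynomial.induction_on' with
  | add f₁ f₂ h₁ h₂ =>
    obtain ⟨g₁, r₁, h₁⟩ := h₁
    obtain ⟨g₂, r₂, h₂⟩ := h₂
    exact ⟨g₁ + g₂, r₁ + r₂, by rw [h₁, h₂, mul_add, C_add]; abel⟩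
  | monomial n a =>
    induction n generalizing a with
    | zero => exact ⟨0, a, by simp⟩
    | succ n ih =>
      obtain ⟨g, r, h⟩ := ih (T * a)
      refine ⟨g + monomial n a, r, ?_⟩
      rw [mul_add, sub_mul _ _ (monomial n a), X_mul_monomial, C_mul_monomial, h]
      abel

/-- The polynomials whose one-sided evaluations at `T` agree and commute with `T`, and whose
two-sided difference quotient vanishes, are those of the form `r + (X - T) * B * (X - T)` with
`r` commuting with `T`. -/
theorem eval_eq_leftEval_and_twoSidedQuot_eq_zero_iff (T : A) (f : A[X]) :
    (f.eval T = leftEval T f ∧ f.eval T * T = T * leftEval T f ∧ twoSidedQuot T f = 0) ↔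
      ∃ r B, Commute r T ∧ f = (X - C T) * B * (X - C T) + C r := by
  constructor
  · rintro ⟨h₁, h₂, h₃⟩
    obtain ⟨g, r, rfl⟩ := exists_eq_mul_X_sub_C_add_C T f
    obtain ⟨B, q, rfl⟩ := exists_eq_X_sub_C_mul_add_C T g
    rw [twoSidedQuot_add, twoSidedQuot_mul_X_sub_C, leftEval_add, leftEval_X_sub_C_mul,
      leftEval_C, twoSidedQuot_C, zero_add, add_zero] at h₃
    rw [← h₁, eval_add, eval_mul_X_sub_C, eval_C, zero_add] at h₂
    exact ⟨r, B, h₂, by rw [h₃, C_0, add_zero]⟩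
  · rintro ⟨r, B, hr, rfl⟩
    rw [twoSidedQuot_add, twoSidedQuot_mul_X_sub_C, leftEval_X_sub_C_mul, twoSidedQuot_C,
      eval_add, eval_mul_X_sub_C, eval_C, leftEval_add, mul_assoc, leftEval_X_sub_C_mul,
      leftEval_C, zero_add, add_zero]
    exact ⟨rfl, hr, rfl⟩

end Evaluation

section Gamma

variable {K : Type*} [Field K] {N : ℕ} {D : ℕ} {S : Matrix (Fin N) (Fin N) K}

theorem Pk_add (k : ℕ) (f g : Polynomial (Matrix (Fin N) (Fin N) K)) :
    Pk D S k (f + g) = Pk D S k f + Pk D S k g := by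
  have h : ∀ j, ((-1 : K) ^ (j - k)) • ((f + g).coeff j * S ^ (j - k - 1) -
      S ^ (j - k - 1) * (f + g).coeff j) =
      ((-1 : K) ^ (j - k)) • (f.coeff j * S ^ (j - k - 1) - S ^ (j - k - 1) * f.coeff j) +
      ((-1 : K) ^ (j - k)) • (g.coeff j * S ^ (j - k - 1) - S ^ (j - k - 1) * g.coeff j) := by
    intro j
    rw [← smul_add, coeff_add, add_mul, mul_add]
    congr 1
    abel
  simp only [Pk, h, Finset.sum_add_distrib]
  rw [coeff_add, smul_add]
  abel

theorem Pk_monomial_of_le {k n : ℕ} (h : n ≤ k) (a : Matrix (Fin N) (Fin N) K) :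
    Pk D S k (monomial n a) = 0 := by
  rw [Pk, coeff_monomial, if_neg (by omega), Finset.sum_eq_zero]
  · simp
  · intro j hj
    have := Finset.mem_Icc.1 hj
    rw [coeff_monomial, if_neg (by omega)]
    simp

theorem neg_pow_eq_smul (m : ℕ) : (-S) ^ m = (-1 : K) ^ m • S ^ m := by
  rw [← _root_.smul_pow, neg_one_smul]

theorem neg_pow_eq_zero (hS : S ^ D = 0) {m : ℕ} (h : D ≤ m) : (-S) ^ m = 0 := by
  rw [neg_pow_eq_smul, pow_eq_zero_of_le h hS, smul_zero]

theorem Pk_monomial_add (hS : S ^ D = 0) (k m : ℕ) (a : Matrix (Fin N) (Fin N) K) :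
    Pk D S k (monomial (k + m + 1) a) =
      (if m = 0 then (k + 1) • a else 0) + (a * (-S) ^ m - (-S) ^ m * a) := by
  have hsum : ∑ j ∈ Finset.Icc (k + 2) (k + D), ((-1 : K) ^ (j - k)) •
      ((monomial (k + m + 1) a).coeff j * S ^ (j - k - 1) -
        S ^ (j - k - 1) * (monomial (k + m + 1) a).coeff j) =
      -(a * (-S) ^ m - (-S) ^ m * a) := by
    rw [Finset.sum_eq_single (k + m + 1)]
    · rw [coeff_monomial_same, neg_pow_eq_smul, show k + m + 1 - k = m + 1 by omega,
        show m + 1 - 1 = m by omega, mul_smul_comm, smul_mul_assoc, ← smul_sub, pow_succ,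
        mul_neg_one, neg_smul]
    · intro j _ hj
      rw [coeff_monomial, if_neg (Ne.symm hj)]
      simp
    · intro hm
      have hm : m = 0 ∨ D ≤ m := by
        rw [Finset.mem_Icc] at hm
        omega
      rw [coeff_monomial_same, show k + m + 1 - k - 1 = m by omega]
      rcases hm with rfl | hm
      · simp
      · rw [pow_eq_zero_of_le hm hS]
        simp
  rw [Pk, hsum, sub_neg_eq_add, coeff_monomial]
  congr 1
  by_cases hm : m = 0 <;> simp [hm]

theorem Pk_zero_X_mul (hS : S ^ D = 0) (f : Polynomial (Matrix (Fin N) (Fin N) K)) :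
    Pk D S 0 (X * f) = f.coeff 0 + (f.eval (-S) - leftEval (-S) f) := by
  induction f using Polynomial.induction_on' with
  | add f g hf hg =>
    rw [mul_add, Pk_add, hf, hg, coeff_add, eval_add, leftEval_add]
    abel
  | monomial n a =>
    have h := Pk_monomial_add hS 0 n a
    rw [zero_add] at h
    rw [X_mul_monomial, h, eval_monomial, leftEval_monomial, coeff_monomial, zero_add, one_smul]

theorem Pk_zero_X_pow_mul_s13 (hS : S ^ D = 0) (j : ℕ) (f : Polynomial (Matrix (Fin N) (Fin N) K)) :
    Pk D S 0 (X ^ (j + 2) * f) =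
      f.eval (-S) * (-S) ^ (j + 1) - (-S) ^ (j + 1) * leftEval (-S) f := by
  induction f using Polynomial.induction_on' with
  | add f g hf hg =>
    rw [mul_add, Pk_add, hf, hg, eval_add, leftEval_add, add_mul, mul_add]
    abel
  | monomial n a =>
    have h := Pk_monomial_add hS 0 (n + (j + 1)) a
    rw [zero_add, if_neg (by omega), zero_add] at h
    rw [X_pow_mul_monomial, show n + (j + 2) = n + (j + 1) + 1 by omega, h, eval_monomial,
      leftEval_monomial, mul_assoc, ← mul_assoc ((-S) ^ (j + 1)), ← pow_add, ← pow_add,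
      add_comm (j + 1) n]

theorem sum_neg_pow_mul_Pk (hS : S ^ D = 0) {n q : ℕ} (h : D ≤ n + q + 1)
    (f : Polynomial (Matrix (Fin N) (Fin N) K)) :
    ∑ k ∈ Finset.range (q + 1), (-S) ^ (k + n) * Pk D S k f =
      (-S) ^ n * twoSidedQuot (-S) f := by
  induction f using Polynomial.induction_on' with
  | add f g hf hg =>
    simp only [Pk_add, mul_add, Finset.sum_add_distrib]
    rw [hf, hg, twoSidedQuot_add, mul_add]
  | monomial i a =>
    have hext : ∑ k ∈ Finset.range (q + 1), (-S) ^ (k + n) * Pk D S k (monomial i a) =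
        ∑ k ∈ Finset.range i, (-S) ^ (k + n) * Pk D S k (monomial i a) := by
      rcases le_total i (q + 1) with hi | hi
      · refine (Finset.sum_subset (Finset.range_mono hi) fun k _ hk => ?_).symm
        rw [Pk_monomial_of_le (by simpa using hk), mul_zero]
      · refine Finset.sum_subset (Finset.range_mono hi) fun k _ hk => ?_
        rw [Finset.mem_range] at hk
        rw [neg_pow_eq_zero hS (by omega), zero_mul]
    rw [hext, twoSidedQuot_monomial]
    cases i with
    | zero => simp
    | succ i =>
      have hterm : ∀ k ∈ Finset.range (i + 1),
          (-S) ^ (k + n) * Pk D S k (monomial (i + 1) a) =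
            (-S) ^ n * ((if k = i then (i + 1) • ((-S) ^ i * a) else 0) +
              ((-S) ^ k * a * (-S) ^ (i + 1 - 1 - k) - (-S) ^ i * a)) := by
        intro k hk
        obtain ⟨m, rfl⟩ : ∃ m, i = k + m := ⟨i - k, by have := Finset.mem_range.1 hk; omega⟩
        rw [Pk_monomial_add hS, add_comm k n, pow_add, mul_assoc,
          show k + m + 1 - 1 - k = m by omega]
        congr 1
        rw [mul_add, mul_sub, pow_add, mul_assoc, mul_assoc]
        congr 1
        by_cases hm : m = 0
        · simp only [hm, add_zero, if_true, mul_smul_comm, pow_zero, one_mul]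
        · simp [hm]
      rw [Finset.sum_congr rfl hterm, ← Finset.mul_sum, Finset.sum_add_distrib,
        Finset.sum_ite_eq', if_pos (by simp), Finset.sum_sub_distrib, Finset.sum_const,
        Finset.card_range]
      congr 1
      abel

theorem mem_GammaSet_iff (hD : 2 ≤ D) (hS : S ^ D = 0)
    (f : Polynomial (Matrix (Fin N) (Fin N) K)) :
    f ∈ GammaSet D S ↔
      ∃ r B, Commute r (-S) ∧ f = (X - C (-S)) * B * (X - C (-S)) + C r := by
  have hsum : ∀ q < D, ∑ k ∈ Finset.range (q + 1),
      ((-1 : K) ^ k) • (S ^ (k + D - q - 1) * Pk D S k f) =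
        (-1 : K) ^ (D - q - 1) • ((-S) ^ (D - q - 1) * twoSidedQuot (-S) f) := by
    intro q hq
    rw [← sum_neg_pow_mul_Pk (q := q) hS (by omega), Finset.smul_sum]
    refine Finset.sum_congr rfl fun k _ => ?_
    rw [show k + D - q - 1 = k + (D - q - 1) by omega, neg_pow_eq_smul, smul_mul_assoc, smul_smul,
      pow_add (-1 : K), mul_left_comm, ← mul_pow, neg_one_mul, neg_neg, one_pow, mul_one]
  have hX : Pk D S 0 (C (f.coeff 0) * X) = f.coeff 0 := by
    rw [← X_mul_C, Pk_zero_X_mul hS, coeff_C_zero, eval_C, leftEval_C, sub_self, add_zero]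
  rw [← eval_eq_leftEval_and_twoSidedQuot_eq_zero_iff, GammaSet, Set.mem_ofPred_eq, hX,
    Pk_zero_X_mul hS, add_eq_left, sub_eq_zero]
  refine and_congr_right fun hfe => and_congr ⟨fun h => ?_, fun h j hj => ?_⟩
    ⟨fun h => ?_, fun h q hq => ?_⟩
  · have h₂ := h 2 le_rfl
    rwa [Pk_zero_X_pow_mul_s13 hS 0, zero_add, pow_one, sub_eq_zero] at h₂
  · obtain ⟨j, rfl⟩ := Nat.exists_eq_add_of_le' hj
    rw [← hfe] at h
    rw [Pk_zero_X_pow_mul_s13 hS, sub_eq_zero, ← hfe]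
    exact (Commute.pow_right h (j + 1)).eq
  · have hq := h (D - 1) (by omega)
    rw [hsum _ (by omega), show D - (D - 1) - 1 = 0 by omega] at hq
    simpa using hq
  · rw [hsum q hq, h, mul_zero, smul_zero]

end Gamma

/-- Γ is a K-subalgebra of M_N(K[x]): it contains the identity, and is
closed under addition, scalar multiplication by K, and multiplication. -/
theorem stmt_13 {K : Type*} [Field K] {N : ℕ} (hN : 1 ≤ N) (D : ℕ) (hD : 2 ≤ D)
    (S : Matrix (Fin N) (Fin N) K) (hS : S ^ D = 0) :
    (1 : Polynomial (Matrix (Fin N) (Fin N) K)) ∈ GammaSet D S ∧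
    (∀ θ₁ θ₂, θ₁ ∈ GammaSet D S → θ₂ ∈ GammaSet D S → θ₁ + θ₂ ∈ GammaSet D S) ∧
    (∀ (a : K) θ, θ ∈ GammaSet D S → a • θ ∈ GammaSet D S) ∧
    (∀ θ₁ θ₂, θ₁ ∈ GammaSet D S → θ₂ ∈ GammaSet D S → θ₁ * θ₂ ∈ GammaSet D S) := by
  simp only [mem_GammaSet_iff hD hS]
  refine ⟨⟨1, 0, Commute.one_left _, by simp⟩, ?_, ?_, ?_⟩
  · rintro _ _ ⟨r₁, B₁, h₁, rfl⟩ ⟨r₂, B₂, h₂, rfl⟩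
    refine ⟨r₁ + r₂, B₁ + B₂, h₁.add_left h₂, ?_⟩
    rw [mul_add, add_mul, C_add]
    abel
  · rintro a _ ⟨r, B, h, rfl⟩
    exact ⟨a • r, a • B, h.smul_left a, by
      rw [smul_add, mul_smul_comm, smul_mul_assoc, smul_C]⟩
  · rintro _ _ ⟨r₁, B₁, h₁, rfl⟩ ⟨r₂, B₂, h₂, rfl⟩
    have hC : ∀ r : Matrix (Fin N) (Fin N) K, Commute r (-S) → Commute (C r) (X - C (-S)) :=
      fun r hr => (commute_X (C r)).symm.sub_right (hr.map C)
    have hC₁ := (hC r₁ h₁).eq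
    have hC₂ := (hC r₂ h₂).eq
    generalize (X - C (-S) : Polynomial (Matrix (Fin N) (Fin N) K)) = p at hC₁ hC₂ ⊢
    refine ⟨r₁ * r₂, B₁ * p * p * B₂ + B₁ * C r₂ + C r₁ * B₂, h₁.mul_left h₂, ?_⟩
    have e₁ : p * B₁ * p * C r₂ = p * (B₁ * C r₂) * p := by
      rw [mul_assoc, ← hC₂]
      simp only [mul_assoc]
    have e₂ : C r₁ * (p * B₂ * p) = p * (C r₁ * B₂) * p := by
      rw [← mul_assoc, ← mul_assoc, hC₁]
      simp only [mul_assoc]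
    rw [add_mul, mul_add, mul_add, e₁, e₂, C_mul, mul_add, mul_add, add_mul, add_mul]
    simp only [mul_assoc]
    abel
end

section
/- Γ contains the two-sided ideal x^{2D} M_N(K[x]): for every p ∈ M_N(K[x]), the matrix polynomial x^{2D}·p(x) belongs to Γ. -/
open Polynomial Finset

/-- `Pk D S k θ` vanishes when all coefficients of `θ` up to degree `k + D` do. -/
theorem Pk_eq_zero_of_coeff_eq_zero {K : Type*} [Field K] {N : ℕ} {D k : ℕ} (hD : 1 ≤ D)
    (S : Matrix (Fin N) (Fin N) K) {θ : Polynomial (Matrix (Fin N) (Fin N) K)}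
    (hθ : ∀ j ≤ k + D, θ.coeff j = 0) : Pk D S k θ = 0 := by
  rw [Pk, hθ (k + 1) (by omega), smul_zero, zero_sub, neg_eq_zero]
  refine Finset.sum_eq_zero fun j hj => ?_
  rw [hθ j (Finset.mem_Icc.mp hj).2, zero_mul, mul_zero, sub_zero, smul_zero]

/-- Γ contains the two-sided ideal x^{2D}·M_N(K[x]). -/
theorem stmt_14 {K : Type*} [Field K] {N : ℕ} (hN : 1 ≤ N) (D : ℕ) (hD : 2 ≤ D)
    (S : Matrix (Fin N) (Fin N) K) (hS : S ^ D = 0)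
    (p : Polynomial (Matrix (Fin N) (Fin N) K)) :
    X ^ (2 * D) * p ∈ GammaSet D S := by
  have h_coeff (m j : ℕ) (hj : j < m) : (X ^ m * p).coeff j = 0 := by
    rw [coeff_X_pow_mul', if_neg (by omega)]
  have h_shift (m : ℕ) : Pk D S 0 (X ^ m * (X ^ (2 * D) * p)) = 0 := by
    rw [← mul_assoc, ← pow_add]
    exact Pk_eq_zero_of_coeff_eq_zero (by omega) S fun j hj => h_coeff _ j (by omega)
  refine ⟨?_, fun j _ => h_shift j, fun q hq => Finset.sum_eq_zero fun k hk => ?_⟩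
  · rw [h_coeff _ 0 (by omega), C_0, zero_mul,
      Pk_eq_zero_of_coeff_eq_zero (by omega) S fun j _ => coeff_zero j]
    simpa using h_shift 1
  · have hk' := Finset.mem_range.mp hk
    rw [Pk_eq_zero_of_coeff_eq_zero (by omega) S fun j hj => h_coeff _ j (by omega),
      mul_zero, smul_zero]
end

section
/- The set Γ_C is a ℂ-subalgebra of M₂(ℂ[z]): it contains the identity matrix, is closed under addition and scalar multiplication by ℂ, and for all F₁, F₂ ∈ Γ_C the product F₁F₂ also lies in Γ_C. -/
open Polynomial

/-- The set Γ_C ⊆ M₂(ℂ[z]) of matrix polynomials of the form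
F(z) = ((a,0),(b−a,b)) + ((c,c),(a−b−c,−c))·z + (1/2)((a−b−c,c+a−b),(d,e))·z² + z³·p(z),
described by linear conditions on the first three coefficient matrices. -/
def GammaC : Set (Polynomial (Matrix (Fin 2) (Fin 2) ℂ)) :=
  {F | (F.coeff 0) 0 1 = 0 ∧
       (F.coeff 0) 1 0 = (F.coeff 0) 1 1 - (F.coeff 0) 0 0 ∧
       (F.coeff 1) 0 1 = (F.coeff 1) 0 0 ∧
       (F.coeff 1) 1 1 = -((F.coeff 1) 0 0) ∧
       (F.coeff 1) 1 0 = (F.coeff 0) 0 0 - (F.coeff 0) 1 1 - (F.coeff 1) 0 0 ∧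
       2 * (F.coeff 2) 0 0 = (F.coeff 0) 0 0 - (F.coeff 0) 1 1 - (F.coeff 1) 0 0 ∧
       2 * (F.coeff 2) 0 1 = (F.coeff 1) 0 0 + (F.coeff 0) 0 0 - (F.coeff 0) 1 1}

/-- Γ_C is a ℂ-subalgebra of M₂(ℂ[z]): it contains the identity and is
closed under addition, scalar multiplication by ℂ, and multiplication. -/
theorem stmt_18 :
    (1 : Polynomial (Matrix (Fin 2) (Fin 2) ℂ)) ∈ GammaC ∧
    (∀ F₁ F₂, F₁ ∈ GammaC → F₂ ∈ GammaC → F₁ + F₂ ∈ GammaC) ∧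
    (∀ (a : ℂ) F, F ∈ GammaC → a • F ∈ GammaC) ∧
    (∀ F₁ F₂, F₁ ∈ GammaC → F₂ ∈ GammaC → F₁ * F₂ ∈ GammaC) := by
  refine ⟨?_, ?_, ?_, ?_⟩
  · simp [GammaC, coeff_one]
  · rintro F G ⟨h1, h2, h3, h4, h5, h6, h7⟩ ⟨k1, k2, k3, k4, k5, k6, k7⟩
    simp only [GammaC, Set.mem_ofPred_eq, coeff_add, Matrix.add_apply]
    refine ⟨?_, ?_, ?_, ?_, ?_, ?_, ?_⟩
    · linear_combination h1 + k1
    · linear_combination h2 + k2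
    · linear_combination h3 + k3
    · linear_combination h4 + k4
    · linear_combination h5 + k5
    · linear_combination h6 + k6
    · linear_combination h7 + k7
  · rintro t F ⟨h1, h2, h3, h4, h5, h6, h7⟩
    simp only [GammaC, Set.mem_ofPred_eq, coeff_smul, Matrix.smul_apply, smul_eq_mul]
    refine ⟨?_, ?_, ?_, ?_, ?_, ?_, ?_⟩
    · linear_combination t * h1
    · linear_combination t * h2
    · linear_combination t * h3
    · linear_combination t * h4
    · linear_combination t * h5
    · linear_combination t * h6
    · linear_combination t * h7
  · rintro F G ⟨h1, h2, h3, h4, h5, h6, h7⟩ ⟨k1, k2, k3, k4, k5, k6, k7⟩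
    rw [mul_comm, ← eq_div_iff two_ne_zero] at h6 h7 k6 k7
    have c2 : (F * G).coeff 2 =
        F.coeff 0 * G.coeff 2 + F.coeff 1 * G.coeff 1 + F.coeff 2 * G.coeff 0 := by
      simp [coeff_mul, Finset.Nat.antidiagonal_succ, add_assoc]
    simp only [GammaC, Set.mem_ofPred_eq, mul_coeff_zero, mul_coeff_one, c2, Matrix.add_apply,
      Matrix.mul_apply, Fin.sum_univ_two, h7, h6, h5, h4, h3, h2, h1, k7, k6, k5, k4, k3, k2, k1]
    refine ⟨?_, ?_, ?_, ?_, ?_, ?_, ?_⟩ <;> ring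
end

section
/- Define in M₂(ℂ[z]): α₁ = ((1,0),(−1,0)) + ((0,0),(1,0))·z + (1/2)((1,1),(0,0))·z², α₂ = ((0,0),(1,1)) + ((0,0),(−1,0))·z + (1/2)((−1,−1),(0,0))·z², α₃ = ((1,1),(−1,−1))·z + (1/2)((−1,1),(0,0))·z², α₄ = (1/2)((0,0),(1,0))·z², α₅ = (1/2)((0,0),(0,1))·z². Then Γ_C contains z³M₂(ℂ[z]) (every matrix polynomial z³p(z) with p ∈ M₂(ℂ[z])), and Γ_C equals the ℂ-subalgebra of M₂(ℂ[z]) generated by {α₁, α₂, α₃, α₄, α₅}. -/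
open Polynomial

noncomputable section

/-- α₁ = ((1,0),(−1,0)) + ((0,0),(1,0))·z + (1/2)((1,1),(0,0))·z². -/
def alpha1 : Polynomial (Matrix (Fin 2) (Fin 2) ℂ) :=
  C !![1, 0; -1, 0] + C !![0, 0; 1, 0] * X + C ((2 : ℂ)⁻¹ • !![1, 1; 0, 0]) * X ^ 2

/-- α₂ = ((0,0),(1,1)) + ((0,0),(−1,0))·z + (1/2)((−1,−1),(0,0))·z². -/
def alpha2 : Polynomial (Matrix (Fin 2) (Fin 2) ℂ) :=
  C !![0, 0; 1, 1] + C !![0, 0; -1, 0] * X + C ((2 : ℂ)⁻¹ • !![-1, -1; 0, 0]) * X ^ 2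

/-- α₃ = ((1,1),(−1,−1))·z + (1/2)((−1,1),(0,0))·z². -/
def alpha3 : Polynomial (Matrix (Fin 2) (Fin 2) ℂ) :=
  C !![1, 1; -1, -1] * X + C ((2 : ℂ)⁻¹ • !![-1, 1; 0, 0]) * X ^ 2

/-- α₄ = (1/2)((0,0),(1,0))·z². -/
def alpha4 : Polynomial (Matrix (Fin 2) (Fin 2) ℂ) :=
  C ((2 : ℂ)⁻¹ • !![0, 0; 1, 0]) * X ^ 2

/-- α₅ = (1/2)((0,0),(0,1))·z². -/
def alpha5 : Polynomial (Matrix (Fin 2) (Fin 2) ℂ) :=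
  C ((2 : ℂ)⁻¹ • !![0, 0; 0, 1]) * X ^ 2

/-- `Γ_C` as a subalgebra of `M₂(ℂ)[z]`. -/
def gammaSubalgebra : Subalgebra ℂ (Polynomial (Matrix (Fin 2) (Fin 2) ℂ)) where
  carrier := GammaC
  algebraMap_mem' r := by
    simp [GammaC, Polynomial.algebraMap_apply, coeff_C, Matrix.algebraMap_matrix_apply]
  add_mem' := by
    rintro F G ⟨f1, f2, f3, f4, f5, f6, f7⟩ ⟨g1, g2, g3, g4, g5, g6, g7⟩
    simp only [GammaC, Set.mem_ofPred_eq, coeff_add, Matrix.add_apply]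
    refine ⟨?_, ?_, ?_, ?_, ?_, ?_, ?_⟩
    · linear_combination f1 + g1
    · linear_combination f2 + g2
    · linear_combination f3 + g3
    · linear_combination f4 + g4
    · linear_combination f5 + g5
    · linear_combination f6 + g6
    · linear_combination f7 + g7
  mul_mem' := by
    rintro F G ⟨f1, f2, f3, f4, f5, f6, f7⟩ ⟨g1, g2, g3, g4, g5, g6, g7⟩
    rw [mul_comm, ← eq_div_iff two_ne_zero] at f6 f7 g6 g7
    have h2 : (F * G).coeff 2 =
        F.coeff 0 * G.coeff 2 + F.coeff 1 * G.coeff 1 + F.coeff 2 * G.coeff 0 := by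
      simp [coeff_mul, Finset.Nat.antidiagonal_succ, add_assoc]
    simp only [GammaC, Set.mem_ofPred_eq, mul_coeff_zero, mul_coeff_one, h2, Matrix.add_apply,
      Matrix.mul_apply, Fin.sum_univ_two, f1, f2, f3, f4, f5, f6, f7, g1, g2, g3, g4, g5, g6, g7]
    refine ⟨?_, ?_, ?_, ?_, ?_, ?_, ?_⟩ <;> ring

/-- The monomial `Eᵢⱼ zⁿ`. -/
def unitMonomial (i j : Fin 2) (n : ℕ) : Polynomial (Matrix (Fin 2) (Fin 2) ℂ) :=
  monomial n (Matrix.single i j 1)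

theorem unitMonomial_mul_same (i j k : Fin 2) (m n : ℕ) :
    unitMonomial i j m * unitMonomial j k n = unitMonomial i k (m + n) := by
  simp [unitMonomial, monomial_mul_monomial]

theorem unitMonomial_mul_of_ne {i j k l : Fin 2} (h : j ≠ k) (m n : ℕ) :
    unitMonomial i j m * unitMonomial k l n = 0 := by
  simp [unitMonomial, monomial_mul_monomial, h]

theorem monomial_eq_unitMonomial (n : ℕ) (A : Matrix (Fin 2) (Fin 2) ℂ) :
    monomial n A = A 0 0 • unitMonomial 0 0 n + A 0 1 • unitMonomial 0 1 n +
      A 1 0 • unitMonomial 1 0 n + A 1 1 • unitMonomial 1 1 n := by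
  simp only [unitMonomial, smul_monomial, ← map_add]
  congr 1
  ext i j
  fin_cases i <;> fin_cases j <;> simp

theorem alpha1_eq : alpha1 = unitMonomial 0 0 0 - unitMonomial 1 0 0 + unitMonomial 1 0 1 +
    (2 : ℂ)⁻¹ • (unitMonomial 0 0 2 + unitMonomial 0 1 2) := by
  rw [alpha1, C_mul_X_pow_eq_monomial, C_mul_X_eq_monomial, ← monomial_zero_left,
    monomial_eq_unitMonomial 0, monomial_eq_unitMonomial 1, monomial_eq_unitMonomial 2]
  simp
  module

theorem alpha3_eq : alpha3 =
    unitMonomial 0 0 1 + unitMonomial 0 1 1 - unitMonomial 1 0 1 - unitMonomial 1 1 1 +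
      (2 : ℂ)⁻¹ • (unitMonomial 0 1 2 - unitMonomial 0 0 2) := by
  rw [alpha3, C_mul_X_pow_eq_monomial, C_mul_X_eq_monomial,
    monomial_eq_unitMonomial 1, monomial_eq_unitMonomial 2]
  simp
  module

theorem alpha4_eq : alpha4 = (2 : ℂ)⁻¹ • unitMonomial 1 0 2 := by
  rw [alpha4, C_mul_X_pow_eq_monomial, monomial_eq_unitMonomial 2]
  simp

theorem alpha5_eq : alpha5 = (2 : ℂ)⁻¹ • unitMonomial 1 1 2 := by
  rw [alpha5, C_mul_X_pow_eq_monomial, monomial_eq_unitMonomial 2]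
  simp

theorem unitMonomial_mem {S : Subalgebra ℂ (Polynomial (Matrix (Fin 2) (Fin 2) ℂ))}
    (h1 : alpha1 ∈ S) (h3 : alpha3 ∈ S) (h4 : alpha4 ∈ S) (h5 : alpha5 ∈ S) (n : ℕ) :
    ∀ i j : Fin 2, unitMonomial i j (n + 3) ∈ S := by
  have mul_ne {i l : Fin 2} (m n : ℕ) : unitMonomial i 0 m * unitMonomial 1 l n = 0 :=
    unitMonomial_mul_of_ne (by decide) m n
  have mul_ne' {i l : Fin 2} (m n : ℕ) : unitMonomial i 1 m * unitMonomial 0 l n = 0 :=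
    unitMonomial_mul_of_ne (by decide) m n
  induction n using Nat.twoStepInduction with
  | zero =>
    have p : (2 : ℂ) • (alpha1 * alpha3 - alpha3 - (3 : ℂ) • alpha4 - alpha5) -
        (2 : ℂ) • (alpha1 * alpha5 - alpha1 * alpha4) ∈ S :=
      sub_mem (S.smul_mem (sub_mem (sub_mem (sub_mem (mul_mem h1 h3) h3) (S.smul_mem h4 _)) h5) _)
        (S.smul_mem (sub_mem (mul_mem h1 h5) (mul_mem h1 h4)) _)
    have q : alpha5 * alpha3 ∈ S := mul_mem h5 h3
    have e10 : unitMonomial 1 0 3 ∈ S := by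
      convert S.smul_mem (add_mem p (S.smul_mem q 2)) (-2)⁻¹ using 1
      simp only [alpha1_eq, alpha3_eq, alpha4_eq, alpha5_eq, mul_add, add_mul, mul_sub, sub_mul,
        smul_mul_assoc, mul_smul_comm, unitMonomial_mul_same, mul_ne, mul_ne']
      module
    have e11 : unitMonomial 1 1 3 ∈ S := by
      convert sub_mem (S.smul_mem q (-2)) e10 using 1
      simp only [alpha3_eq, alpha5_eq, mul_add, mul_sub,
        smul_mul_assoc, mul_smul_comm, unitMonomial_mul_same, mul_ne']
      module
    have e00 : unitMonomial 0 0 3 ∈ S := by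
      convert add_mem (S.smul_mem (sub_mem (mul_mem h3 h4)
        (mul_mem h1 h4)) 2) e10 using 1
      simp only [alpha1_eq, alpha3_eq, alpha4_eq, add_mul, sub_mul,
        smul_mul_assoc, mul_smul_comm, unitMonomial_mul_same, mul_ne]
      module
    have e01 : unitMonomial 0 1 3 ∈ S := by
      convert add_mem (S.smul_mem (sub_mem (mul_mem h3 h5)
        (mul_mem h1 h5)) 2) e11 using 1
      simp only [alpha1_eq, alpha3_eq, alpha5_eq, add_mul, sub_mul,
        smul_mul_assoc, mul_smul_comm, unitMonomial_mul_same, mul_ne]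
      module
    simp [Fin.forall_fin_two, e00, e01, e10, e11]
  | one =>
    have top {β : Polynomial (Matrix (Fin 2) (Fin 2) ℂ)} {j : Fin 2} (hβ : β ∈ S)
        (h : β = (2 : ℂ)⁻¹ • unitMonomial 1 j 2) : unitMonomial 0 j 4 ∈ S := by
      convert S.smul_mem (mul_mem h1 hβ) 4 using 1
      simp only [h, alpha1_eq, add_mul, sub_mul,
        smul_mul_assoc, mul_smul_comm, unitMonomial_mul_same, mul_ne]
      module
    have bottom {β : Polynomial (Matrix (Fin 2) (Fin 2) ℂ)} {j : Fin 2} (hβ : β ∈ S)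
        (h : β = (2 : ℂ)⁻¹ • unitMonomial 1 j 2) : unitMonomial 1 j 4 ∈ S := by
      convert S.smul_mem (mul_mem h5 hβ) 4 using 1
      simp only [h, alpha5_eq, smul_mul_assoc, mul_smul_comm, unitMonomial_mul_same]
      module
    simp [Fin.forall_fin_two, top h4 alpha4_eq, top h5 alpha5_eq, bottom h4 alpha4_eq,
      bottom h5 alpha5_eq]
  | more n ih _ =>
    intro i
    have left : unitMonomial i 0 (n + 3 + 2) ∈ S := by
      convert S.smul_mem (mul_mem (ih i 1) h4) 2 using 1
      simp [alpha4_eq, unitMonomial_mul_same]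
    have right : unitMonomial i 1 (n + 3 + 2) ∈ S := by
      convert S.smul_mem (mul_mem (ih i 1) h5) 2 using 1
      simp [alpha5_eq, unitMonomial_mul_same]
    simpa [Fin.forall_fin_two, add_right_comm] using And.intro left right

theorem X_pow_three_mul_mem {S : Subalgebra ℂ (Polynomial (Matrix (Fin 2) (Fin 2) ℂ))}
    (h1 : alpha1 ∈ S) (h3 : alpha3 ∈ S) (h4 : alpha4 ∈ S) (h5 : alpha5 ∈ S)
    (p : Polynomial (Matrix (Fin 2) (Fin 2) ℂ)) : X ^ 3 * p ∈ S := by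
  induction p using Polynomial.induction_on' with
  | add p q hp hq => simpa [mul_add] using add_mem hp hq
  | monomial n A =>
    have mem := unitMonomial_mem h1 h3 h4 h5 n
    rw [X_pow_mul_monomial, monomial_eq_unitMonomial]
    exact add_mem (add_mem (add_mem (S.smul_mem (mem _ _) _) (S.smul_mem (mem _ _) _))
      (S.smul_mem (mem _ _) _)) (S.smul_mem (mem _ _) _)

theorem exists_eq_add_X_pow_three_mul {F : Polynomial (Matrix (Fin 2) (Fin 2) ℂ)}
    (hF : F ∈ GammaC) : ∃ (a b c d e : ℂ) (p : Polynomial (Matrix (Fin 2) (Fin 2) ℂ)),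
      F = a • alpha1 + b • alpha2 + c • alpha3 + d • alpha4 + e • alpha5 + X ^ 3 * p := by
  obtain ⟨f1, f2, f3, f4, f5, f6, f7⟩ := hF
  rw [mul_comm, ← eq_div_iff two_ne_zero] at f6 f7
  refine ⟨F.coeff 0 0 0, F.coeff 0 1 1, F.coeff 1 0 0, 2 * F.coeff 2 1 0, 2 * F.coeff 2 1 1, ?_⟩
  suffices h : X ^ 3 ∣ F - (F.coeff 0 0 0 • alpha1 + F.coeff 0 1 1 • alpha2 +
      F.coeff 1 0 0 • alpha3 + (2 * F.coeff 2 1 0) • alpha4 + (2 * F.coeff 2 1 1) • alpha5) by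
    obtain ⟨p, hp⟩ := h
    exact ⟨p, by rw [← hp]; abel⟩
  rw [X_pow_dvd_iff]
  intro n hn
  ext i j
  interval_cases n <;> fin_cases i <;> fin_cases j <;>
    simp [alpha1, alpha2, alpha3, alpha4, alpha5, coeff_X, coeff_C, coeff_X_pow, f1, f2, f3, f4,
      f5, f6, f7] <;> ring

/-- Γ_C contains z³·M₂(ℂ[z]) and equals the ℂ-subalgebra of M₂(ℂ[z])
generated by {α₁, α₂, α₃, α₄, α₅}. -/
theorem stmt_19 :
    (∀ p : Polynomial (Matrix (Fin 2) (Fin 2) ℂ), X ^ 3 * p ∈ GammaC) ∧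
    GammaC = (Algebra.adjoin ℂ
      ({alpha1, alpha2, alpha3, alpha4, alpha5} :
        Set (Polynomial (Matrix (Fin 2) (Fin 2) ℂ))) : Subalgebra ℂ _) := by
  refine ⟨fun p => by simp [GammaC, coeff_X_pow_mul'], subset_antisymm ?_ ?_⟩
  · intro F hF
    obtain ⟨a, b, c, d, e, p, rfl⟩ := exists_eq_add_X_pow_three_mul hF
    have mem := Algebra.subset_adjoin (R := ℂ) (s := {alpha1, alpha2, alpha3, alpha4, alpha5})
    simp only [Set.insert_subset_iff, Set.singleton_subset_iff, SetLike.mem_coe] at mem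
    obtain ⟨h1, h2, h3, h4, h5⟩ := mem
    exact add_mem (add_mem (add_mem (add_mem (add_mem (Subalgebra.smul_mem _ h1 a)
      (Subalgebra.smul_mem _ h2 b)) (Subalgebra.smul_mem _ h3 c)) (Subalgebra.smul_mem _ h4 d))
      (Subalgebra.smul_mem _ h5 e)) (X_pow_three_mul_mem h1 h3 h4 h5 p)
  · change Algebra.adjoin ℂ _ ≤ gammaSubalgebra
    rw [Algebra.adjoin_le_iff]
    rintro _ (rfl | rfl | rfl | rfl | rfl) <;> change _ ∈ GammaC <;>
      simp [GammaC, alpha1, alpha2, alpha3, alpha4, alpha5, coeff_X, coeff_C, coeff_X_pow]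

end
end
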